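/- Consider the allocation linear program over a partition P: maximize Σ_i Σ_{C ∈ P} w_C · x_{i,C} · a_i · p_{i,C} over x_{i,C} ∈ [0,1] subject to Σ_{C ∈ P} w_C · x_{i,C} · a_i · p_{i,C} ≤ B_i for each i and Σ_i x_{i,C} ≤ 1 for each C, where a_i ≥ 0 and B_i ≥ 0. If partition P_A refines partition P_B, then the optimal value of the LP over P_A is at least the optimal value of the LP over P_B. In particular, LP welfare (with a_i = v_i) and, for tCPA bidders, LP surrogate revenue (with a_i = t_i) are monotone under model refinement. -/

import Mathlib

/-!
STATEMENT 10: LP optimal-value monotonicity under refinement.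
The allocation LP over a partition `P` maximizes `Σ_i Σ_{C ∈ P} w_C · x_{i,C} · a_i · p_{i,C}`
over `x_{i,C} ∈ [0,1]` subject to budgets `Σ_C w_C · x_{i,C} · a_i · p_{i,C} ≤ B_i` and
supply `Σ_i x_{i,C} ≤ 1`. If `P_A` refines `P_B`, then the optimal value over `P_A` is at
least the optimal value over `P_B` (covering LP welfare with `a_i = v_i` and, for tCPA
bidders, LP surrogate revenue with `a_i = t_i`).
-/

/-- `P` is a partition of the finite set `U` into nonempty, pairwise disjoint clusters. -/
def IsPartition {α : Type*} [DecidableEq α] (U : Finset α) (P : Finset (Finset α)) : Prop :=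
  (∀ C ∈ P, C.Nonempty) ∧
  (∀ C ∈ P, ∀ D ∈ P, C ≠ D → Disjoint C D) ∧
  P.biUnion id = U

/-- The weight of cluster `C`: `w_C = |C| / |U|`. -/
noncomputable def weight {α : Type*} (U C : Finset α) : ℝ :=
  (C.card : ℝ) / (U.card : ℝ)

/-- The predicted conversion probability on cluster `C`. -/
noncomputable def clusterPred {α : Type*} (p : α → ℝ) (C : Finset α) : ℝ :=
  (∑ u ∈ C, p u) / (C.card : ℝ)

/-- `P_A` refines `P_B`: every cluster of `P_A` is contained in some cluster of `P_B`. -/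
def Refines {α : Type*} (PA PB : Finset (Finset α)) : Prop :=
  ∀ C ∈ PA, ∃ D ∈ PB, C ⊆ D

/-- The optimal value of the allocation LP over partition `P`. -/
noncomputable def lpValue {α ι : Type*} [Fintype ι]
    (U : Finset α) (P : Finset (Finset α)) (a B : ι → ℝ) (p : ι → α → ℝ) : ℝ :=
  sSup { r : ℝ | ∃ x : ι → Finset α → ℝ,
    (∀ i, ∀ C ∈ P, x i C ∈ Set.Icc (0 : ℝ) 1) ∧
    (∀ i, ∑ C ∈ P, weight U C * x i C * a i * clusterPred (p i) C ≤ B i) ∧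
    (∀ C ∈ P, ∑ i, x i C ≤ 1) ∧
    r = ∑ i, ∑ C ∈ P, weight U C * x i C * a i * clusterPred (p i) C }

/-- The contribution of a cluster to the LP is a sum over its users. -/
theorem weight_mul_clusterPred {α : Type*} (U C : Finset α) (p : α → ℝ) :
    weight U C * clusterPred p C = (∑ u ∈ C, p u) / (U.card : ℝ) := by
  rcases C.eq_empty_or_nonempty with rfl | hC
  · simp [weight, clusterPred]
  · have h : (C.card : ℝ) ≠ 0 := by exact_mod_cast hC.card_pos.ne'
    unfold weight clusterPred
    rw [div_mul_div_comm, mul_comm (U.card : ℝ), mul_div_mul_left _ _ h]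

/-- A cluster of the coarse partition is the union of the fine clusters assigned to it. -/
theorem biUnion_filter_eq {α : Type*} [DecidableEq α] {U : Finset α}
    {PA PB : Finset (Finset α)} (hPA : IsPartition U PA) (hPB : IsPartition U PB)
    {f : Finset α → Finset α} (hf : ∀ C ∈ PA, f C ∈ PB ∧ C ⊆ f C)
    {D : Finset α} (hD : D ∈ PB) :
    (PA.filter (fun C => f C = D)).biUnion id = D := by
  ext u
  simp only [Finset.mem_biUnion, Finset.mem_filter, id]
  constructor
  · rintro ⟨C, ⟨hC, rfl⟩, hu⟩
    exact (hf C hC).2 hu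
  · intro hu
    have huU : u ∈ PA.biUnion id := by
      rw [hPA.2.2, ← hPB.2.2]
      exact Finset.mem_biUnion.2 ⟨D, hD, hu⟩
    obtain ⟨C, hC, huC⟩ := Finset.mem_biUnion.1 huU
    refine ⟨C, ⟨hC, ?_⟩, huC⟩
    by_contra hne
    exact Finset.disjoint_left.1 (hPB.2.1 _ (hf C hC).1 D hD hne) ((hf C hC).2 huC) hu

/-- Copying a coarse allocation to the fine clusters preserves each advertiser's LP term. -/
theorem sum_refine_eq {α : Type*} [DecidableEq α] {U : Finset α}
    {PA PB : Finset (Finset α)} (hPA : IsPartition U PA) (hPB : IsPartition U PB)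
    {f : Finset α → Finset α} (hf : ∀ C ∈ PA, f C ∈ PB ∧ C ⊆ f C)
    (x : Finset α → ℝ) (c : ℝ) (p : α → ℝ) :
    ∑ C ∈ PA, weight U C * x (f C) * c * clusterPred p C =
      ∑ D ∈ PB, weight U D * x D * c * clusterPred p D := by
  have key : ∀ (C : Finset α) (y : ℝ),
      weight U C * y * c * clusterPred p C = y * c / (U.card : ℝ) * ∑ u ∈ C, p u := by
    intro C y
    calc weight U C * y * c * clusterPred p C
        = y * c * (weight U C * clusterPred p C) := by ring
      _ = _ := by rw [weight_mul_clusterPred]; ring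
  simp only [key]
  rw [← Finset.sum_fiberwise_of_maps_to (fun C hC => (hf C hC).1)]
  refine Finset.sum_congr rfl fun D hD => ?_
  have hdisj : Set.PairwiseDisjoint (↑(PA.filter (fun C => f C = D))) (id : Finset α → _) := by
    intro C hC E hE hne
    exact hPA.2.1 C (Finset.mem_filter.1 hC).1 E (Finset.mem_filter.1 hE).1 hne
  conv_rhs => rw [← biUnion_filter_eq hPA hPB hf hD, Finset.sum_biUnion hdisj]
  rw [biUnion_filter_eq hPA hPB hf hD, Finset.mul_sum]
  refine Finset.sum_congr rfl fun C hC => ?_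
  rw [(Finset.mem_filter.1 hC).2, id]

theorem lp_value_monotone {α ι : Type*} [DecidableEq α] [Fintype ι]
    (U : Finset α) (hU : U.Nonempty)
    (PA PB : Finset (Finset α)) (hPA : IsPartition U PA) (hPB : IsPartition U PB)
    (href : Refines PA PB)
    (a : ι → ℝ) (ha : ∀ i, 0 ≤ a i)
    (B : ι → ℝ) (hB : ∀ i, 0 ≤ B i)
    (p : ι → α → ℝ) (hp : ∀ i u, p i u ∈ Set.Icc (0 : ℝ) 1) :
    lpValue U PB a B p ≤ lpValue U PA a B p := by
  choose! f hf using href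
  unfold lpValue
  refine csSup_le_csSup ?_ ?_ ?_
  · refine ⟨∑ i, B i, ?_⟩
    rintro r ⟨x, -, hbudget, -, rfl⟩
    exact Finset.sum_le_sum fun i _ => hbudget i
  · exact ⟨0, fun _ _ => 0, by simp, by simpa using hB, by simp, by simp⟩
  · rintro r ⟨x, hx, hbudget, hsupply, rfl⟩
    refine ⟨fun i C => x i (f C), fun i C hC => hx i _ (hf C hC).1, fun i => ?_,
      fun C hC => hsupply _ (hf C hC).1, ?_⟩
    · exact (sum_refine_eq hPA hPB hf (x i) (a i) (p i)).trans_le (hbudget i)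
    · exact Finset.sum_congr rfl fun i _ => (sum_refine_eq hPA hPB hf (x i) (a i) (p i)).symm
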